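/- Let g be a real symmetric invertible 4×4 matrix of Lorentzian signature, and let U ∈ ℝ⁴ satisfy Uᵀ g U < 0. Then the symmetric 4×4 matrix with entries W^{ab} = U^a U^b − (1/2)(Uᵀ g U)(g^{-1})^{ab} is positive definite. -/

import Mathlib

open Matrix

/-- The Minkowski matrix diag(-1,1,1,1). -/
def minkowskiMat : Matrix (Fin 4) (Fin 4) ℝ :=
  Matrix.diagonal (fun i => if i = 0 then -1 else 1)

/-- A real symmetric 4×4 matrix has Lorentzian signature if it is congruent to
diag(-1,1,1,1). -/
def IsLorentzian (g : Matrix (Fin 4) (Fin 4) ℝ) : Prop :=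
  ∃ P : Matrix (Fin 4) (Fin 4) ℝ, IsUnit P.det ∧ Pᵀ * g * P = minkowskiMat

theorem sq_add_mul_pos_of_timelike {t n a m k : ℝ} (hn : 0 ≤ n) (hm : 0 ≤ m)
    (ht : n < t ^ 2) (hk : k ^ 2 ≤ n * m) (hne : a ≠ 0 ∨ 0 < m) :
    0 < (t * a + k) ^ 2 + (1 / 2) * (t ^ 2 - n) * (m - a ^ 2) := by
  have hD : 0 < t ^ 2 - n := sub_pos.mpr ht
  have hA : 0 < (1 / 2) * (t ^ 2 + n) := by linarith
  refine pos_of_mul_pos_right (a := (1 / 2) * (t ^ 2 + n)) ?_ hA.le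
  have key : (1 / 2) * (t ^ 2 + n) *
      ((t * a + k) ^ 2 + (1 / 2) * (t ^ 2 - n) * (m - a ^ 2)) =
      ((1 / 2) * (t ^ 2 + n) * a + t * k) ^ 2 +
        (1 / 2) * (t ^ 2 - n) * ((n * m - k ^ 2) + (1 / 2) * (t ^ 2 - n) * m) := by ring
  rw [key]
  have hnm : 0 ≤ n * m - k ^ 2 := sub_nonneg.mpr hk
  rcases hm.eq_or_lt with rfl | hm'
  · have ha : a ≠ 0 := hne.resolve_right (lt_irrefl _)
    have hk0 : k = 0 := by
      rw [mul_zero] at hk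
      exact pow_eq_zero_iff two_ne_zero |>.mp (le_antisymm hk (sq_nonneg k))
    subst hk0
    have : 0 < ((1 / 2) * (t ^ 2 + n) * a) ^ 2 := by positivity
    simpa using this
  · positivity

theorem minkowski_energy_form_pos (V y : Fin 4 → ℝ)
    (hV : V ⬝ᵥ minkowskiMat *ᵥ V < 0) (hy : y ≠ 0) :
    0 < (V ⬝ᵥ y) ^ 2 - (1 / 2) * (V ⬝ᵥ minkowskiMat *ᵥ V) * (y ⬝ᵥ minkowskiMat *ᵥ y) := by
  have form (z : Fin 4 → ℝ) : z ⬝ᵥ minkowskiMat *ᵥ z =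
      (z 1 ^ 2 + z 2 ^ 2 + z 3 ^ 2) - z 0 ^ 2 := by
    simp [minkowskiMat, dotProduct, mulVec_diagonal, Fin.sum_univ_four]
    ring
  rw [form] at hV
  rw [form, form]
  have hne : y 0 ≠ 0 ∨ 0 < y 1 ^ 2 + y 2 ^ 2 + y 3 ^ 2 := by
    by_contra! h
    obtain ⟨h0, h⟩ := h
    apply hy
    have h1 : y 1 = 0 := by nlinarith [sq_nonneg (y 1), sq_nonneg (y 2), sq_nonneg (y 3)]
    have h2 : y 2 = 0 := by nlinarith [sq_nonneg (y 1), sq_nonneg (y 2), sq_nonneg (y 3)]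
    have h3 : y 3 = 0 := by nlinarith [sq_nonneg (y 1), sq_nonneg (y 2), sq_nonneg (y 3)]
    ext i
    fin_cases i <;> assumption
  have hCS : (V 1 * y 1 + V 2 * y 2 + V 3 * y 3) ^ 2 ≤
      (V 1 ^ 2 + V 2 ^ 2 + V 3 ^ 2) * (y 1 ^ 2 + y 2 ^ 2 + y 3 ^ 2) := by
    linarith [sq_nonneg (V 1 * y 2 - V 2 * y 1), sq_nonneg (V 1 * y 3 - V 3 * y 1),
      sq_nonneg (V 2 * y 3 - V 3 * y 2)]
  have := sq_add_mul_pos_of_timelike (t := V 0) (a := y 0) (by positivity) (by positivity)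
    (sub_neg.mp hV) hCS hne
  simp only [dotProduct, Fin.sum_univ_four]
  linarith

theorem minkowskiMat_mul_self : minkowskiMat * minkowskiMat = 1 := by
  rw [minkowskiMat, diagonal_mul_diagonal, ← diagonal_one]
  congr 1
  ext i
  split_ifs <;> norm_num

theorem inv_eq_of_congr_minkowskiMat {g P : Matrix (Fin 4) (Fin 4) ℝ}
    (h : Pᵀ * g * P = minkowskiMat) : g⁻¹ = P * minkowskiMat * Pᵀ := by
  apply inv_eq_left_inv
  have h1 : (minkowskiMat * Pᵀ * g) * P = 1 := by
    rw [Matrix.mul_assoc, Matrix.mul_assoc, ← Matrix.mul_assoc Pᵀ, h, minkowskiMat_mul_self]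
  have h2 := mul_eq_one_comm.mp h1
  simpa only [Matrix.mul_assoc] using h2

/-- For a Lorentzian metric `g` and a timelike vector `U`, the matrix
`W^{ab} = U^a U^b - (1/2)(Uᵀ g U)(g⁻¹)^{ab}` is positive definite. -/
theorem energy_tensor_posDef (g : Matrix (Fin 4) (Fin 4) ℝ) (hsym : g.IsSymm)
    (hinv : IsUnit g.det) (hlor : IsLorentzian g)
    (U : Fin 4 → ℝ) (hU : U ⬝ᵥ g.mulVec U < 0) :
    (Matrix.of fun a b => U a * U b - (1/2) * (U ⬝ᵥ g.mulVec U) * g⁻¹ a b).PosDef := by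
  obtain ⟨P, hP, hPg⟩ := hlor
  have hginv := inv_eq_of_congr_minkowskiMat hPg
  obtain ⟨V, hUV⟩ : ∃ V, U = P *ᵥ V := ⟨P⁻¹ *ᵥ U, by
    rw [mulVec_mulVec, mul_nonsing_inv P hP, one_mulVec]⟩
  have hs : U ⬝ᵥ g *ᵥ U = V ⬝ᵥ minkowskiMat *ᵥ V := by
    rw [← hPg, ← mulVec_mulVec, ← hUV, ← mulVec_mulVec, dotProduct_mulVec V,
      vecMul_transpose, ← hUV]
  have hW : (Matrix.of fun a b => U a * U b - (1 / 2) * (U ⬝ᵥ g *ᵥ U) * g⁻¹ a b) =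
      vecMulVec U U - ((1 / 2) * (U ⬝ᵥ g *ᵥ U)) • g⁻¹ := by
    ext a b
    simp [vecMulVec_apply]
  rw [hW]
  refine PosDef.of_dotProduct_mulVec_pos ?_ fun x hx => ?_
  · rw [IsHermitian, conjTranspose_eq_transpose_of_trivial, transpose_sub, transpose_smul,
      transpose_nonsing_inv, hsym.eq, transpose_vecMulVec]
  · have hy : Pᵀ *ᵥ x ≠ 0 := fun h =>
      hx (eq_zero_of_mulVec_eq_zero (by rw [det_transpose]; exact hP.ne_zero) h)
    have hVy : V ⬝ᵥ Pᵀ *ᵥ x = x ⬝ᵥ U := by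
      rw [dotProduct_mulVec, vecMul_transpose, ← hUV, dotProduct_comm]
    have hyy : x ⬝ᵥ g⁻¹ *ᵥ x = (Pᵀ *ᵥ x) ⬝ᵥ minkowskiMat *ᵥ (Pᵀ *ᵥ x) := by
      rw [hginv, ← mulVec_mulVec, ← mulVec_mulVec, dotProduct_mulVec, mulVec_transpose]
    have hpos := minkowski_energy_form_pos V (Pᵀ *ᵥ x) (hs ▸ hU) hy
    rw [← hs, ← hyy, hVy] at hpos
    have hUx : x ⬝ᵥ vecMulVec U U *ᵥ x = (x ⬝ᵥ U) ^ 2 := by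
      rw [vecMulVec_mulVec, op_smul_eq_smul, dotProduct_smul, dotProduct_comm U x, smul_eq_mul, sq]
    rwa [star_trivial, sub_mulVec, dotProduct_sub, smul_mulVec, dotProduct_smul, smul_eq_mul, hUx]
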